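/- Let a group G act on a measure space (M, μ) with μ G-invariant, let n ∈ ℕ, let ρ : G → GL(n, ℂ) be a group homomorphism, and let κ : M × M → Matrix(n, n, ℂ) be a measurable kernel that is G-equivariant: κ(z • m, z • m') = ρ(z) · κ(m, m') · ρ(z)⁻¹ for all z ∈ G and m, m' ∈ M. Let f : M → ℂ be measurable and x, y ∈ G, and assume the relevant integrands are integrable. Then ∫_M f(x⁻¹ • m) · tr(ρ(y) · κ(y⁻¹ • m, m)) dμ(m) = ∫_M f(m) · tr(ρ(x⁻¹ y x) · κ((x⁻¹ y⁻¹ x) • m, m)) dμ(m). -/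

import Mathlib

open MeasureTheory

/-- Let a group `G` act on a measure space `(M, μ)` with `μ`
`G`-invariant, `ρ : G → GL(n, ℂ)` a homomorphism, and `κ : M × M → Mₙ(ℂ)` a measurable
`G`-equivariant kernel: `κ (z • m, z • m') = ρ z * κ (m, m') * (ρ z)⁻¹`. Then for
measurable `f : M → ℂ` and `x, y ∈ G` (assuming the integrands are integrable),
`∫_M f (x⁻¹ • m) tr (ρ y * κ (y⁻¹ • m, m)) dμ
  = ∫_M f m * tr (ρ (x⁻¹ y x) * κ ((x⁻¹ y⁻¹ x) • m, m)) dμ`. -/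
theorem integral_shift_kernel_trace
    {G M : Type*} [Group G] [MulAction G M] [MeasurableSpace M]
    (μ : Measure M)
    (hμinv : ∀ z : G, Measure.map (fun m : M => z • m) μ = μ)
    (n : ℕ) (ρ : G →* Matrix.GeneralLinearGroup (Fin n) ℂ)
    (κ : M × M → Matrix (Fin n) (Fin n) ℂ)
    (hκmeas : ∀ i j : Fin n, Measurable (fun p : M × M => κ p i j))
    (hκequiv : ∀ (z : G) (m m' : M),
      κ (z • m, z • m') =
        (ρ z : Matrix (Fin n) (Fin n) ℂ) * κ (m, m') *
          ((ρ z)⁻¹ : Matrix.GeneralLinearGroup (Fin n) ℂ))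
    (f : M → ℂ) (hf : Measurable f) (x y : G)
    (hint₁ : Integrable (fun m : M =>
      f (x⁻¹ • m) * Matrix.trace ((ρ y : Matrix (Fin n) (Fin n) ℂ) * κ (y⁻¹ • m, m))) μ)
    (hint₂ : Integrable (fun m : M =>
      f m * Matrix.trace ((ρ (x⁻¹ * y * x) : Matrix (Fin n) (Fin n) ℂ) *
        κ ((x⁻¹ * y⁻¹ * x) • m, m))) μ) :
    ∫ m : M,
        f (x⁻¹ • m) * Matrix.trace ((ρ y : Matrix (Fin n) (Fin n) ℂ) * κ (y⁻¹ • m, m)) ∂μ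
      = ∫ m : M,
          f m * Matrix.trace ((ρ (x⁻¹ * y * x) : Matrix (Fin n) (Fin n) ℂ) *
            κ ((x⁻¹ * y⁻¹ * x) • m, m)) ∂μ := by
  by_cases hx : AEMeasurable (fun m : M => x • m) μ
  · have hm := hμinv x
    have hs := hint₁.aestronglyMeasurable
    rw [← hm] at hs
    have key := integral_map hx hs
    rw [hm] at key
    rw [key]
    congr 1
    funext m
    have h1 : y⁻¹ • x • m = x • ((x⁻¹ * y⁻¹ * x) • m) := by
      simp only [smul_smul]
      congr 1
      group
    rw [inv_smul_smul, h1, hκequiv, ← mul_assoc, Matrix.trace_mul_comm, ← mul_assoc, ← mul_assoc]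
    simp only [map_mul, map_inv, Units.val_mul]
  · have h0 := hμinv x
    rw [Measure.map_of_not_aemeasurable hx] at h0
    rw [← h0]
    simp
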